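/- arXiv:1904.02267 — 3 statements merged into one kernel-verified Lean document; each statement's English description precedes it below -/
import Mathlib

section
/- Fix a positive integer d, a partition λ = (λ_1, …, λ_ℓ) of d, an integer a, and a finitely supported function n : {1,2,3,…} → ℕ. For a partition μ of d, let FS(μ; a', n) denote the sum of 1/|Aut(M)| over equivalence classes of fully simple maps M with ℓ(μ) boundary faces of degrees μ_1, …, μ_{ℓ(μ)}, with −χ(M) = a', and with exactly n(i) internal faces of degree i for every i ≥ 1; let Ord(λ; a, n) denote the analogous sum over equivalence classes of all (not necessarily fully simple) maps with boundary face degrees λ_1, …, λ_ℓ, −χ(M) = a, and n(i) internal faces of degree i. Then Ord(λ; a, n) = z(λ) · Σ_{μ ⊢ d} Σ_{k ≥ 0} H^<_k(λ; μ) · FS(μ; a − k, n), where the inner sum has only finitely many nonzero terms. -/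
open Equiv

namespace FSM

/-- The number of cycles of a permutation (counting fixed points), i.e. the number of
orbits, realised as the cardinality of the quotient of the underlying set by the
`SameCycle` relation. -/
noncomputable def cycleCount {α : Type*} (σ : Perm α) : ℕ :=
  Nat.card (Quot σ.SameCycle)

/-- The size of the cycle (orbit) of `σ` containing `x`, counting fixed points as
cycles of length `1`. -/
noncomputable def orbitSize {α : Type*} (σ : Perm α) (x : α) : ℕ :=
  Nat.card {y : α // σ.SameCycle x y}

/-- The cycle type of a permutation including parts equal to `1` for the fixed points. -/
noncomputable def fullCycleType {α : Type*} [Fintype α] [DecidableEq α] (σ : Perm α) :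
    Multiset ℕ :=
  σ.cycleType + Multiset.replicate (Fintype.card α - σ.support.card) 1

/-- A list of permutations is a strictly monotone sequence of transpositions if each
entry is a transposition `(aᵢ bᵢ)` with `aᵢ < bᵢ` and the sequence `b₁, b₂, …` is
strictly increasing. -/
def IsStrictlyMonotone {d : ℕ} (l : List (Perm (Fin d))) : Prop :=
  ∃ ab : List (Fin d × Fin d),
    l = ab.map (fun p => Equiv.swap p.1 p.2) ∧
    (∀ p ∈ ab, p.1 < p.2) ∧
    List.Chain' (· < ·) (ab.map Prod.snd)

/-- A list of permutations is a weakly monotone sequence of transpositions if each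
entry is a transposition `(aᵢ bᵢ)` with `aᵢ < bᵢ` and the sequence `b₁, b₂, …` is
weakly increasing. -/
def IsWeaklyMonotone {d : ℕ} (l : List (Perm (Fin d))) : Prop :=
  ∃ ab : List (Fin d × Fin d),
    l = ab.map (fun p => Equiv.swap p.1 p.2) ∧
    (∀ p ∈ ab, p.1 < p.2) ∧
    List.Chain' (· ≤ ·) (ab.map Prod.snd)

/-- The strictly monotone Hurwitz number `H^<_k(λ; μ)`: `1/d!` times the number of
tuples `(ρ_λ, τ₁, …, τ_k, ρ_μ)` with `ρ_λ` of cycle type `λ`, `ρ_μ` of cycle type `μ`,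
`τ₁, …, τ_k` a strictly monotone sequence of transpositions and
`ρ_λ τ₁ ⋯ τ_k ρ_μ = id`. -/
noncomputable def Hstrict (d k : ℕ) (lam mu : Nat.Partition d) : ℚ :=
  (Nat.card {t : Perm (Fin d) × List (Perm (Fin d)) × Perm (Fin d) //
      fullCycleType t.1 = lam.parts ∧ fullCycleType t.2.2 = mu.parts ∧
      t.2.1.length = k ∧ IsStrictlyMonotone t.2.1 ∧
      t.1 * t.2.1.prod * t.2.2 = 1} : ℚ) / (d.factorial : ℚ)

/-- The weakly monotone Hurwitz number `H^≤_k(λ; μ)`. -/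
noncomputable def Hweak (d k : ℕ) (lam mu : Nat.Partition d) : ℚ :=
  (Nat.card {t : Perm (Fin d) × List (Perm (Fin d)) × Perm (Fin d) //
      fullCycleType t.1 = lam.parts ∧ fullCycleType t.2.2 = mu.parts ∧
      t.2.1.length = k ∧ IsWeaklyMonotone t.2.1 ∧
      t.1 * t.2.1.prod * t.2.2 = 1} : ℚ) / (d.factorial : ℚ)

/-- `z(λ) = ∏ᵢ λᵢ · ∏ⱼ mⱼ(λ)!`. -/
def zPart {d : ℕ} (lam : Nat.Partition d) : ℕ :=
  lam.parts.prod * ∏ j ∈ lam.parts.toFinset, (lam.parts.count j).factorial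

end FSM
namespace FSM

/-- The permutation model of a map with `n` (ordered, rooted) boundary faces on the set
`Fin m` of oriented edges: `s1` is a fixed-point-free involution, `s0 s1 s2 = id`, and
no two roots lie in the same cycle of `s2`. -/
structure MapData (m n : ℕ) where
  s0 : Perm (Fin m)
  s1 : Perm (Fin m)
  s2 : Perm (Fin m)
  R : Fin n → Fin m
  s1_invol : s1 * s1 = 1
  s1_fpf : ∀ x, s1 x ≠ x
  rel : s0 * s1 * s2 = 1
  roots_distinct : ∀ i j, s2.SameCycle (R i) (R j) → i = j

namespace MapData

variable {m n : ℕ}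

/-- The list of degrees of the boundary faces. -/
noncomputable def boundaryDegrees (M : MapData m n) : List ℕ :=
  List.ofFn fun i => orbitSize M.s2 (M.R i)

/-- The number of internal faces (cycles of `s2` containing no root) of degree `i`. -/
noncomputable def internalCount (M : MapData m n) (i : ℕ) : ℕ :=
  Nat.card {q : Quot M.s2.SameCycle //
    orbitSize M.s2 q.out = i ∧ ∀ j, ¬ M.s2.SameCycle (M.R j) q.out}

/-- The Euler characteristic of the map, with the interiors of the boundary faces
removed: `χ = c(σ₀) - c(σ₁) + c(σ₂) - n`. -/
noncomputable def eulerChar (M : MapData m n) : ℤ :=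
  (cycleCount M.s0 : ℤ) - cycleCount M.s1 + cycleCount M.s2 - n

/-- A map is fully simple if no two boundary edges (elements of `σ₂`-orbits of roots)
lie in the same cycle of `s0`. -/
def FullySimple (M : MapData m n) : Prop :=
  ∀ x y : Fin m, (∃ i, M.s2.SameCycle (M.R i) x) → (∃ i, M.s2.SameCycle (M.R i) y) →
    M.s0.SameCycle x y → x = y

end MapData

/-- Equivalence of maps: a relabelling of the oriented edges conjugating the three
permutations and carrying the tuple of roots to the tuple of roots. -/
def MapEquivRel {m n : ℕ} (M M' : MapData m n) : Prop :=
  ∃ φ : Perm (Fin m),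
    φ * M.s0 * φ⁻¹ = M'.s0 ∧ φ * M.s1 * φ⁻¹ = M'.s1 ∧ φ * M.s2 * φ⁻¹ = M'.s2 ∧
    ∀ i, φ (M.R i) = M'.R i

/-- The number of automorphisms (self-equivalences) of a map. -/
noncomputable def autCard {m n : ℕ} (M : MapData m n) : ℕ :=
  Nat.card {φ : Perm (Fin m) //
    φ * M.s0 * φ⁻¹ = M.s0 ∧ φ * M.s1 * φ⁻¹ = M.s1 ∧ φ * M.s2 * φ⁻¹ = M.s2 ∧
    ∀ i, φ (M.R i) = M.R i}

/-- The conditions defining the enumeration: boundary face degrees given by the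
partition `degs` (listed in a fixed, sorted, order), `-χ(M) = a`, `nf i` internal faces
of degree `i` for every `i`, and (if `fs = true`) fully simplicity. -/
def MCond {m n : ℕ} (degs : Multiset ℕ) (a : ℤ) (nf : ℕ →₀ ℕ) (fs : Bool)
    (M : MapData m n) : Prop :=
  M.boundaryDegrees = degs.sort (· ≤ ·) ∧
  -M.eulerChar = a ∧
  (∀ i, M.internalCount i = nf i) ∧
  (fs = true → M.FullySimple)

/-- The weighted enumeration of (fully simple, if `fs = true`) maps with boundary face
degrees `p`, Euler characteristic `-a` and `nf i` internal faces of degree `i`: the sum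
of `1/|Aut M|` over equivalence classes of such maps.  Any such map has
`d + Σᵢ i · nf i` oriented edges, so all equivalence classes are realised on the model
edge set `Fin (d + Σᵢ i · nf i)`. -/
noncomputable def mapEnum (d : ℕ) (p : Nat.Partition d) (a : ℤ) (nf : ℕ →₀ ℕ)
    (fs : Bool) : ℚ :=
  ∑ᶠ c : Quot (fun M M' : {M : MapData (d + nf.sum fun i k => i * k)
      (Multiset.card p.parts) // MCond p.parts a nf fs M} => MapEquivRel M.1 M'.1),
    (1 : ℚ) / (autCard c.out.1 : ℚ)

end FSM
namespace FSM

section Cycles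

variable {α β : Type*}

theorem quot_mk_eq_iff {s : Perm α} {x y : α} :
    Quot.mk s.SameCycle x = Quot.mk s.SameCycle y ↔ s.SameCycle x y :=
  (Perm.SameCycle.equivalence s).quot_mk_eq_iff x y

theorem sameCycle_out (s : Perm α) (x : α) :
    s.SameCycle (Quot.mk s.SameCycle x).out x :=
  quot_mk_eq_iff.1 (Quot.out_eq _)

theorem orbitSize_congr {s : Perm α} {x y : α} (h : s.SameCycle x y) :
    orbitSize s x = orbitSize s y :=
  Nat.card_congr (Equiv.subtypeEquivRight fun _ => ⟨h.symm.trans, h.trans⟩)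

theorem orbitSize_eq_minimalPeriod [Finite α] (s : Perm α) (x : α) :
    orbitSize s x = Function.minimalPeriod (s • ·) x := by
  classical
  have := Fintype.ofFinite (MulAction.orbit (Subgroup.zpowers s) x)
  rw [MulAction.minimalPeriod_eq_card, ← Nat.card_eq_fintype_card]
  refine Nat.card_congr (Equiv.subtypeEquivRight fun y => ?_)
  simp only [MulAction.mem_orbit_iff, Subtype.exists, Subgroup.mem_zpowers_iff]
  constructor
  · rintro ⟨k, hk⟩
    exact ⟨s ^ k, ⟨k, rfl⟩, hk⟩
  · rintro ⟨_, ⟨k, rfl⟩, hk⟩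
    exact ⟨k, hk⟩

theorem zpow_apply_eq_iff [Finite α] (s : Perm α) (x : α) (k : ℤ) :
    (s ^ k) x = x ↔ (orbitSize s x : ℤ) ∣ k := by
  rw [orbitSize_eq_minimalPeriod, ← MulAction.zpow_smul_eq_iff_minimalPeriod_dvd]
  rfl

theorem zpow_apply_eq_zpow_apply_iff [Finite α] (s : Perm α) (x : α) (k l : ℤ) :
    (s ^ k) x = (s ^ l) x ↔ (orbitSize s x : ℤ) ∣ k - l := by
  rw [← zpow_apply_eq_iff, show k - l = -l + k by ring, zpow_add, Perm.mul_apply, zpow_neg,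
    Perm.inv_eq_iff_eq]

theorem zpow_apply_of_semiconj {ρ : Perm α} {s : Perm β} {f : α → β}
    (h : ∀ x, s (f x) = f (ρ x)) (k : ℤ) (x : α) : (s ^ k) (f x) = f ((ρ ^ k) x) := by
  induction k using Int.induction_on generalizing x with
  | zero => simp
  | succ n ih => rw [zpow_add_one, zpow_add_one, Perm.mul_apply, Perm.mul_apply, h, ih]
  | pred n ih =>
    rw [zpow_sub_one, zpow_sub_one, Perm.mul_apply, Perm.mul_apply, ← ih]
    congr 1
    rw [Perm.inv_eq_iff_eq, h, ← Perm.mul_apply, mul_inv_cancel, Perm.one_apply]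

theorem sameCycle_iff_of_semiconj {ρ : Perm α} {s : Perm β} (f : α ↪ β)
    (h : ∀ x, s (f x) = f (ρ x)) (x y : α) : s.SameCycle (f x) (f y) ↔ ρ.SameCycle x y :=
  exists_congr fun k => by rw [zpow_apply_of_semiconj h, f.injective.eq_iff]

theorem mem_range_of_sameCycle {ρ : Perm α} {s : Perm β} {f : α ↪ β}
    (h : ∀ x, s (f x) = f (ρ x)) {x : α} {y : β} (hy : s.SameCycle (f x) y) :
    y ∈ Set.range f := by
  obtain ⟨k, rfl⟩ := hy
  exact ⟨(ρ ^ k) x, (zpow_apply_of_semiconj h k x).symm⟩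

theorem orbitSize_of_semiconj {ρ : Perm α} {s : Perm β} (f : α ↪ β)
    (h : ∀ x, s (f x) = f (ρ x)) (x : α) : orbitSize s (f x) = orbitSize ρ x := by
  symm
  refine Nat.card_congr (Equiv.ofBijective
    (fun y => ⟨f y.1, (sameCycle_iff_of_semiconj f h _ _).2 y.2⟩) ⟨?_, ?_⟩)
  · intro y z hyz
    exact Subtype.ext (f.injective (Subtype.ext_iff.1 hyz))
  · rintro ⟨y, hy⟩
    obtain ⟨z, rfl⟩ := mem_range_of_sameCycle h hy
    exact ⟨⟨z, (sameCycle_iff_of_semiconj f h _ _).1 hy⟩, rfl⟩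

/-- If `g` induces an injection on cycles, the cycles upstairs are counted by the cycles
which meet the range of `g`. -/
theorem cycleCount_eq_card_meeting {ρ : Perm α} {s : Perm β} (g : α → β)
    (h : ∀ x y, ρ.SameCycle x y ↔ s.SameCycle (g x) (g y)) :
    cycleCount ρ = Nat.card {q : Quot s.SameCycle // ∃ x, s.SameCycle (g x) q.out} := by
  refine Nat.card_congr (Equiv.ofBijective
    (fun q => ⟨Quot.mk _ (g q.out), q.out, (sameCycle_out _ _).symm⟩) ⟨?_, ?_⟩)
  · intro p q hpq
    have := quot_mk_eq_iff.1 (Subtype.ext_iff.1 hpq)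
    rw [← h, ← quot_mk_eq_iff] at this
    simpa using this
  · rintro ⟨q, x, hx⟩
    refine ⟨Quot.mk _ x, Subtype.ext ?_⟩
    exact (quot_mk_eq_iff.2 (((h _ _).1 (sameCycle_out ρ x)).trans hx)).trans (Quot.out_eq q)

theorem cycleCount_eq_add [Finite β] {ρ : Perm α} {s : Perm β} (g : α → β)
    (h : ∀ x y, ρ.SameCycle x y ↔ s.SameCycle (g x) (g y)) :
    cycleCount s = cycleCount ρ +
      Nat.card {q : Quot s.SameCycle // ∀ x, ¬ s.SameCycle (g x) q.out} := by
  classical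
  rw [cycleCount_eq_card_meeting g h, cycleCount,
    ← Nat.card_congr (Equiv.sumCompl fun q : Quot s.SameCycle => ∃ x, s.SameCycle (g x) q.out),
    Nat.card_sum]
  simp only [not_exists]

theorem pow_apply_eq_of_avoids [Finite β] {s t : Perm β} {g : α → β}
    (hst : ∀ x, (∀ i, ¬ s.SameCycle (g i) x) → t x = s x) {x : β}
    (hx : ∀ i, ¬ s.SameCycle (g i) x) (n : ℕ) : (t ^ n) x = (s ^ n) x := by
  induction n with
  | zero => simp
  | succ n ih =>
    rw [pow_succ', pow_succ', Perm.mul_apply, Perm.mul_apply, ih]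
    exact hst _ fun i hi => hx i (Perm.sameCycle_pow_right.1 hi)

theorem sameCycle_iff_of_avoids [Finite β] {s t : Perm β} {g : α → β}
    (hst : ∀ x, (∀ i, ¬ s.SameCycle (g i) x) → t x = s x) {x : β}
    (hx : ∀ i, ¬ s.SameCycle (g i) x) (y : β) : t.SameCycle x y ↔ s.SameCycle x y := by
  constructor <;> intro h <;> obtain ⟨n, rfl⟩ := h.exists_nat_pow_eq
  · rw [pow_apply_eq_of_avoids hst hx]
    exact ⟨n, by simp⟩
  · rw [← pow_apply_eq_of_avoids hst hx]
    exact ⟨n, by simp⟩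

theorem card_avoiding_le [Finite β] {s t : Perm β} {g : α → β}
    (hst : ∀ x, (∀ i, ¬ s.SameCycle (g i) x) → t x = s x) (J : Set ℕ) :
    Nat.card {q : Quot s.SameCycle // orbitSize s q.out ∈ J ∧ ∀ i, ¬ s.SameCycle (g i) q.out} ≤
      Nat.card {q : Quot t.SameCycle //
        orbitSize t q.out ∈ J ∧ ∀ i, ¬ t.SameCycle (g i) q.out} := by
  refine Nat.card_le_card_of_injective
    (fun q => ⟨Quot.mk _ q.1.out, ?_, fun i hi => ?_⟩) fun p q hpq => ?_
  · rw [orbitSize_congr (sameCycle_out t q.1.out)]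
    have : orbitSize t q.1.out = orbitSize s q.1.out :=
      Nat.card_congr (Equiv.subtypeEquivRight (sameCycle_iff_of_avoids hst q.2.2))
    rw [this]
    exact q.2.1
  · have h := (hi.trans (sameCycle_out t q.1.out)).symm
    rw [sameCycle_iff_of_avoids hst q.2.2] at h
    exact q.2.2 i h.symm
  · have h := quot_mk_eq_iff.1 (Subtype.ext_iff.1 hpq)
    rw [sameCycle_iff_of_avoids hst p.2.2, ← quot_mk_eq_iff] at h
    exact Subtype.ext (by simpa using h)

theorem card_avoiding_eq [Finite β] {s t : Perm β} {g : α → β}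
    (hst : ∀ x, (∀ i, ¬ s.SameCycle (g i) x) → t x = s x)
    (hts : ∀ x, (∀ i, ¬ t.SameCycle (g i) x) → s x = t x) (J : Set ℕ) :
    Nat.card {q : Quot s.SameCycle // orbitSize s q.out ∈ J ∧ ∀ i, ¬ s.SameCycle (g i) q.out} =
      Nat.card {q : Quot t.SameCycle //
        orbitSize t q.out ∈ J ∧ ∀ i, ¬ t.SameCycle (g i) q.out} :=
  le_antisymm (card_avoiding_le hst J) (card_avoiding_le hts J)

theorem cycleCount_one : cycleCount (1 : Perm α) = Nat.card α :=
  (Nat.card_congr (Equiv.ofBijective (Quot.mk (1 : Perm α).SameCycle)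
    ⟨fun _ _ h => Perm.sameCycle_one.1 (quot_mk_eq_iff.1 h), Quot.mk_surjective⟩)).symm

theorem notMem_range_of_avoids {s : Perm β} {f : α ↪ β} {x : β}
    (hx : ∀ i, ¬ s.SameCycle (f i) x) : x ∉ Set.range f := by
  rintro ⟨i, rfl⟩
  exact hx i (Perm.SameCycle.refl _ _)

theorem notMem_range_apply_of_avoids {s : Perm β} {f : α ↪ β} {x : β}
    (hx : ∀ i, ¬ s.SameCycle (f i) x) : s x ∉ Set.range f :=
  notMem_range_of_avoids fun i hi => hx i (Perm.sameCycle_apply_right.1 hi)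

/-- The cycles of `s` pass through the image of `f` at most once each. -/
def Separates (s : Perm β) (f : α ↪ β) : Prop :=
  ∀ i j, s.SameCycle (f i) (f j) → i = j

theorem exists_first_return [Finite β] (s : Perm β) (f : α ↪ β) (i : α) :
    ∃ n : ℕ, 0 < n ∧ (s ^ n) (f i) ∈ Set.range f ∧
      ∀ k, 0 < k → k < n → (s ^ k) (f i) ∉ Set.range f := by
  classical
  have H : ∃ n : ℕ, 0 < n ∧ (s ^ n) (f i) ∈ Set.range f :=
    ⟨orderOf s, orderOf_pos s, i, by simp [pow_orderOf_eq_one]⟩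
  exact ⟨Nat.find H, (Nat.find_spec H).1, (Nat.find_spec H).2,
    fun k hk hkn hmem => Nat.find_min H hkn ⟨hk, hmem⟩⟩

theorem sameCycle_viaEmbedding_mul_iff [Finite β] {s : Perm β} {f : α ↪ β}
    (hs : Separates s f) (r : Perm α) (i j : α) :
    r.SameCycle i j ↔ (r.viaEmbedding f * s).SameCycle (f i) (f j) := by
  classical
  constructor
  · have step : ∀ i, (r.viaEmbedding f * s).SameCycle (f i) (f (r i)) := by
      intro i
      obtain ⟨n, hn, ⟨j, hj⟩, hmin⟩ := exists_first_return s f i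
      have hij : i = j := hs i j ⟨n, by simp [hj]⟩
      subst hij
      have key : ∀ k, k < n → ((r.viaEmbedding f * s) ^ k) (f i) = (s ^ k) (f i) := by
        intro k
        induction k with
        | zero => simp
        | succ k ih =>
          intro hk
          rw [pow_succ', Perm.mul_apply, ih (by omega), Perm.mul_apply, ← Perm.mul_apply s,
            ← pow_succ']
          exact Perm.viaEmbedding_apply_of_notMem _ _ _ (hmin _ (by omega) hk)
      refine ⟨n, ?_⟩
      obtain ⟨k, rfl⟩ : ∃ k, n = k + 1 := ⟨n - 1, by omega⟩
      rw [zpow_natCast, pow_succ', Perm.mul_apply, key k (by omega), Perm.mul_apply,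
        ← Perm.mul_apply s, ← pow_succ', ← hj, Perm.viaEmbedding_apply]
    have := Finite.of_injective f f.injective
    intro h
    obtain ⟨n, rfl⟩ := h.exists_nat_pow_eq
    induction n with
    | zero => exact Perm.SameCycle.refl _ _
    | succ n ih =>
      rw [pow_succ', Perm.mul_apply]
      exact (ih ⟨n, by simp⟩).trans (step _)
  · let c : β → Set α := fun x => {k | ∃ l, s.SameCycle (f l) x ∧ r.SameCycle l k}
    have hc : ∀ i, c (f i) = {k | r.SameCycle i k} := by
      intro i
      ext k
      constructor
      · rintro ⟨l, hl, hlk⟩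
        rwa [← hs l i hl]
      · intro hk
        exact ⟨i, Perm.SameCycle.refl _ _, hk⟩
    have hcs : ∀ x, c (s x) = c x := by
      intro x
      simp only [c, Perm.sameCycle_apply_right]
    have hcr : ∀ x, c (r.viaEmbedding f x) = c x := by
      intro x
      by_cases hx : x ∈ Set.range f
      · obtain ⟨l, rfl⟩ := hx
        rw [Perm.viaEmbedding_apply, hc, hc]
        simp only [Perm.sameCycle_apply_left]
      · rw [Perm.viaEmbedding_apply_of_notMem _ _ _ hx]
    intro h
    obtain ⟨n, hn⟩ := h.exists_nat_pow_eq
    have key : ∀ n : ℕ, c (((r.viaEmbedding f * s) ^ n) (f i)) = c (f i) := by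
      intro n
      induction n with
      | zero => rfl
      | succ n ih => rw [pow_succ', Perm.mul_apply, Perm.mul_apply, hcr, hcs, ih]
    have hj := key n
    rw [hn, hc, hc] at hj
    have : j ∈ {k | r.SameCycle j k} := Perm.SameCycle.refl _ _
    rw [hj] at this
    exact this

theorem cycleCount_viaEmbedding_mul [Finite β] {s : Perm β} {f : α ↪ β}
    (hs : Separates s f) (r : Perm α) :
    cycleCount (r.viaEmbedding f * s) + Nat.card α = cycleCount s + cycleCount r := by
  have h1 := cycleCount_eq_add f (sameCycle_viaEmbedding_mul_iff hs r)
  have h2 := cycleCount_eq_add (ρ := (1 : Perm α)) (s := s) f fun i j => by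
    rw [Perm.sameCycle_one]
    exact ⟨fun h => h ▸ Perm.SameCycle.refl _ _, hs i j⟩
  have h3 := card_avoiding_eq (s := s) (t := r.viaEmbedding f * s) (g := f)
    (fun x hx => Perm.viaEmbedding_apply_of_notMem _ _ _ (notMem_range_apply_of_avoids hx))
    (fun x hx => by
      have := notMem_range_apply_of_avoids hx
      rw [Perm.mul_apply] at this ⊢
      by_cases h : s x ∈ Set.range f
      · obtain ⟨i, hi⟩ := h
        rw [← hi, Perm.viaEmbedding_apply] at this
        exact absurd ⟨_, rfl⟩ this
      · rw [Perm.viaEmbedding_apply_of_notMem _ _ _ h]) Set.univ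
  simp only [Set.mem_univ, true_and] at h3
  rw [cycleCount_one] at h2
  omega

theorem exists_separates_viaEmbedding_mul [Finite β] (s : Perm β) (f : α ↪ β) :
    ∃ r : Perm α, Separates ((r.viaEmbedding f)⁻¹ * s) f := by
  have := Finite.of_injective f f.injective
  choose n hn hmem hmin using exists_first_return s f
  choose g hg using hmem
  have hinj : Function.Injective g := by
    have aux : ∀ i j, n i ≤ n j → g i = g j → i = j := by
      intro i j hij h
      have e : (s ^ n i) (f i) = (s ^ n j) (f j) := by rw [← hg, ← hg, h]
      rw [← Nat.add_sub_cancel' hij, pow_add, Perm.mul_apply, (s ^ n i).injective.eq_iff] at e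
      rcases hij.eq_or_lt with h0 | h0
      · rw [h0, Nat.sub_self] at e
        exact f.injective e
      · exact absurd ⟨i, e⟩ (hmin j (n j - n i) (by omega) (by have := hn i; omega))
    intro i j h
    rcases le_total (n i) (n j) with h' | h'
    · exact aux i j h' h
    · exact (aux j i h' h.symm).symm
  let r : Perm α := Equiv.ofBijective g (Finite.injective_iff_bijective.1 hinj)
  have hinv : ∀ x, x ∉ Set.range f → (r.viaEmbedding f)⁻¹ x = x := fun x hx => by
    rw [Perm.inv_eq_iff_eq, Perm.viaEmbedding_apply_of_notMem _ _ _ hx]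
  refine ⟨r, fun i j hij => ?_⟩
  set t := (r.viaEmbedding f)⁻¹ * s with ht
  have key : ∀ k, k < n i → (t ^ k) (f i) = (s ^ k) (f i) := by
    intro k
    induction k with
    | zero => simp
    | succ k ih =>
      intro hk
      rw [pow_succ', Perm.mul_apply, ih (by omega), ht, Perm.mul_apply, ← Perm.mul_apply s,
        ← pow_succ']
      exact hinv _ (hmin i _ (by omega) hk)
  have hper : (t ^ n i) (f i) = f i := by
    obtain ⟨k, hk⟩ : ∃ k, n i = k + 1 := ⟨n i - 1, by have := hn i; omega⟩
    rw [hk, pow_succ', Perm.mul_apply, key k (by omega), ht, Perm.mul_apply,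
      ← Perm.mul_apply s, ← pow_succ', ← hk, ← hg, Perm.inv_eq_iff_eq, Perm.viaEmbedding_apply]
    rfl
  obtain ⟨k, hk⟩ := hij.exists_nat_pow_eq
  have hmul : ∀ q : ℕ, ((t ^ n i) ^ q) (f i) = f i := by
    intro q
    induction q with
    | zero => rfl
    | succ q ih => rw [pow_succ, Perm.mul_apply, hper, ih]
  rw [← Nat.mod_add_div k (n i), pow_add, Perm.mul_apply, pow_mul, hmul,
    key _ (Nat.mod_lt _ (hn i))] at hk
  rcases Nat.eq_zero_or_pos (k % n i) with h0 | h0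
  · rw [h0, pow_zero] at hk
    exact f.injective hk
  · exact absurd ⟨j, hk.symm⟩ (hmin i _ h0 (Nat.mod_lt _ (hn i)))

theorem cycleCount_le [Finite α] (s : Perm α) : cycleCount s ≤ Nat.card α :=
  Nat.card_le_card_of_surjective (Quot.mk s.SameCycle) Quot.mk_surjective

theorem eq_one_of_card_le_cycleCount [Finite α] {s : Perm α} (h : Nat.card α ≤ cycleCount s) :
    s = 1 := by
  have := (Nat.bijective_iff_surjective_and_card (Quot.mk s.SameCycle)).2
    ⟨Quot.mk_surjective, le_antisymm h (cycleCount_le s)⟩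
  ext x
  exact this.1 (quot_mk_eq_iff.2 (Perm.sameCycle_apply_left.2 (Perm.SameCycle.refl _ _)))

theorem eq_one_of_separates_viaEmbedding_mul [Finite β] {s : Perm β} {f : α ↪ β}
    (hs : Separates s f) {r : Perm α} (hr : Separates (r.viaEmbedding f * s) f) : r = 1 := by
  have := Finite.of_injective f f.injective
  have hi : (r⁻¹).viaEmbedding f = (r.viaEmbedding f)⁻¹ :=
    map_inv (Perm.viaEmbeddingHom f) r
  have h1 := cycleCount_viaEmbedding_mul hs r
  have h2 := cycleCount_viaEmbedding_mul hr r⁻¹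
  rw [hi, inv_mul_cancel_left] at h2
  have h3 := cycleCount_le r
  have h4 := cycleCount_le r⁻¹
  exact eq_one_of_card_le_cycleCount (by omega)

end Cycles
section CycleType

theorem orbitSize_eq_one_iff {α : Type*} [Finite α] (s : Perm α) (x : α) :
    orbitSize s x = 1 ↔ s x = x := by
  have h := zpow_apply_eq_iff s x 1
  rw [zpow_one] at h
  rw [h]
  norm_cast
  rw [Nat.dvd_one]

theorem fullCycleType_eq_map {α : Type*} [Fintype α] [DecidableEq α] (s : Perm α)
    [Fintype (Quot s.SameCycle)] :
    fullCycleType s =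
      (Finset.univ : Finset (Quot s.SameCycle)).val.map fun q => orbitSize s q.out := by
  classical
  have hcard : ∀ x, s x ≠ x → orbitSize s x = (s.cycleOf x).support.card := fun x hx => by
    rw [orbitSize, Nat.card_eq_fintype_card, Fintype.card_subtype]
    congr 1
    ext y
    simp [Perm.mem_support_cycleOf_iff' hx]
  rw [← Multiset.filter_add_not (fun q : Quot s.SameCycle => s q.out ≠ q.out)
    (Finset.univ : Finset (Quot s.SameCycle)).val, Multiset.map_add, fullCycleType]
  congr 1
  · rw [Perm.cycleType_def]
    symm
    refine Multiset.map_eq_map_of_bij_of_nodup _ _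
      (Multiset.Nodup.filter _ (Finset.nodup _)) (Finset.nodup _)
      (fun q _ => s.cycleOf q.out) ?_ ?_ ?_ ?_
    · intro q hq
      exact Perm.cycleOf_mem_cycleFactorsFinset_iff.2
        (Perm.mem_support.2 (Multiset.mem_filter.1 hq).2)
    · intro q hq q' hq' h
      have : s.SameCycle q.out q'.out :=
        (Perm.sameCycle_iff_cycleOf_eq_of_mem_support
          (Perm.mem_support.2 (Multiset.mem_filter.1 hq).2)
          (Perm.mem_support.2 (Multiset.mem_filter.1 hq').2)).2 h
      rw [← quot_mk_eq_iff] at this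
      simpa using this
    · intro c hc
      obtain ⟨x, hx⟩ := (Perm.mem_cycleFactorsFinset_iff.1 hc).1.nonempty_support
      have hcx := Perm.cycle_is_cycleOf hx hc
      have hout := sameCycle_out s x
      refine ⟨Quot.mk _ x, Multiset.mem_filter.2 ⟨Finset.mem_univ _, fun h => ?_⟩, ?_⟩
      · have : s x ≠ x :=
          Perm.mem_support.1 (Perm.mem_cycleFactorsFinset_support_le hc hx)
        exact this (hout.apply_eq_self_iff.1 h)
      · rw [hcx]
        exact hout.cycleOf_eq
    · intro q hq
      exact hcard _ (Multiset.mem_filter.1 hq).2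
  · symm
    rw [Multiset.eq_replicate]
    constructor
    · rw [Multiset.card_map, ← Finset.card_compl]
      refine Finset.card_bij (s := Finset.univ.filter fun q : Quot s.SameCycle =>
        ¬ s q.out ≠ q.out) (fun q _ => q.out) ?_ ?_ ?_
      · intro q hq
        simpa using hq
      · intro q _ q' _ h
        rw [← Quot.out_eq q, h, Quot.out_eq]
      · intro x hx
        have hx' : s x = x := by simpa using hx
        have h1 := sameCycle_out s x
        have h2 : (Quot.mk s.SameCycle x).out = x := by
          obtain ⟨k, hk⟩ := h1.symm
          rw [← hk, Perm.zpow_apply_eq_self_of_apply_eq_self hx']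
        refine ⟨Quot.mk _ x, ?_, h2⟩
        simp [h2, hx']
    · intro b hb
      obtain ⟨q, hq, rfl⟩ := Multiset.mem_map.1 hb
      exact (orbitSize_eq_one_iff s _).2 (not_not.1 (Multiset.mem_filter.1 hq).2)

theorem card_fullCycleType {α : Type*} [Fintype α] [DecidableEq α] (s : Perm α) :
    Multiset.card (fullCycleType s) = cycleCount s := by
  classical
  have := Fintype.ofFinite (Quot s.SameCycle)
  rw [fullCycleType_eq_map, Multiset.card_map, cycleCount, Nat.card_eq_fintype_card]
  rfl

theorem fullCycleType_eq_partition_parts {α : Type*} [Fintype α] [DecidableEq α] (s : Perm α) :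
    fullCycleType s = s.partition.parts := by
  rw [Perm.parts_partition, fullCycleType]

theorem fullCycleType_inv {α : Type*} [Fintype α] [DecidableEq α] (s : Perm α) :
    fullCycleType s⁻¹ = fullCycleType s := by
  rw [fullCycleType, fullCycleType, Perm.cycleType_inv, Perm.support_inv]

/-- The cycle type of a permutation of `Fin d` as a partition of `d`. -/
noncomputable def cyclePartition {d : ℕ} (s : Perm (Fin d)) : Nat.Partition d where
  parts := fullCycleType s
  parts_pos := fun h => s.partition.parts_pos (fullCycleType_eq_partition_parts s ▸ h)
  parts_sum := by rw [fullCycleType_eq_partition_parts, s.partition.parts_sum, Fintype.card_fin]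

theorem fullCycleType_eq_iff {d : ℕ} (s : Perm (Fin d)) (p : Nat.Partition d) :
    fullCycleType s = p.parts ↔ cyclePartition s = p :=
  (Nat.Partition.ext_iff (x := cyclePartition s) (y := p)).symm

theorem exists_ordered_cycle_roots {d : ℕ} {p : Nat.Partition d} {ρ : Perm (Fin d)}
    (hρ : fullCycleType ρ = p.parts) :
    ∃ R : Fin (Multiset.card p.parts) → Fin d,
      (List.ofFn fun i => orbitSize ρ (R i)) = p.parts.sort (· ≤ ·) ∧
      (∀ i j, ρ.SameCycle (R i) (R j) → i = j) ∧ ∀ x, ∃ i, ρ.SameCycle (R i) x := by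
  classical
  have := Fintype.ofFinite (Quot ρ.SameCycle)
  have hc : Fintype.card (Quot ρ.SameCycle) = Multiset.card p.parts := by
    rw [← hρ, card_fullCycleType, cycleCount, Nat.card_eq_fintype_card]
  let e := (Fintype.equivFinOfCardEq hc).symm
  let g : Fin (Multiset.card p.parts) → ℕ := fun i => orbitSize ρ (e i).out
  have hg : (List.ofFn g : Multiset ℕ) = p.parts := by
    have h := fullCycleType_eq_map ρ
    rw [← Multiset.map_univ_val_equiv e, Multiset.map_map, hρ, Fin.univ_val_map] at h
    exact h.symm
  refine ⟨fun i => (e (Tuple.sort g i)).out, ?_, ?_, ?_⟩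
  · have hperm : (List.ofFn (g ∘ Tuple.sort g)).Perm (p.parts.sort (· ≤ ·)) := by
      refine (Equiv.Perm.ofFn_comp_perm _ _).trans ?_
      rw [← Multiset.coe_eq_coe, Multiset.sort_eq, hg]
    exact hperm.eq_of_pairwise' (List.pairwise_ofFn.2 fun i j hij => Tuple.monotone_sort g hij.le)
      (Multiset.pairwise_sort _ _)
  · intro i j hij
    rw [← quot_mk_eq_iff] at hij
    simpa using hij
  · intro x
    refine ⟨(Tuple.sort g).symm (e.symm (Quot.mk _ x)), ?_⟩
    simpa using sameCycle_out ρ x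

theorem card_fullCycleType_eq_mul_zPart {d : ℕ} (p : Nat.Partition d) :
    Nat.card {ρ : Perm (Fin d) // fullCycleType ρ = p.parts} * zPart p = d.factorial := by
  classical
  set m := p.parts.filter (2 ≤ ·) with hm
  set c := d - m.sum with hc
  have hsplit : p.parts = m + Multiset.replicate c 1 := by
    have h1 : p.parts.filter (fun i => ¬ 2 ≤ i) =
        Multiset.replicate (Multiset.card (p.parts.filter fun i => ¬ 2 ≤ i)) 1 :=
      Multiset.eq_replicate.2 ⟨rfl, fun b hb => by
        have h := Multiset.mem_filter.1 hb
        have := p.parts_pos h.1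
        omega⟩
    have h2 := Multiset.filter_add_not (2 ≤ ·) p.parts
    rw [← hm, h1] at h2
    have h3 := congrArg Multiset.sum h2
    rw [p.parts_sum, Multiset.sum_add, Multiset.sum_replicate, smul_eq_mul, mul_one] at h3
    have h4 : Multiset.card (p.parts.filter fun i => ¬ 2 ≤ i) = c := by omega
    rw [← h4, h2]
  have hle : m.sum ≤ d := by
    have h := congrArg Multiset.sum hsplit
    rw [p.parts_sum, Multiset.sum_add] at h
    omega
  have hm2 : ∀ a ∈ m, 2 ≤ a := fun a ha => (Multiset.mem_filter.1 ha).2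
  have hiff : ∀ ρ : Perm (Fin d), fullCycleType ρ = p.parts ↔ ρ.cycleType = m := by
    intro ρ
    constructor
    · intro h
      rw [fullCycleType_eq_partition_parts] at h
      rw [hm, ← h, Perm.filter_parts_partition_eq_cycleType]
    · intro h
      rw [fullCycleType, ← Perm.sum_cycleType, h, Fintype.card_fin, hsplit]
  have h1 : m.count 1 = 0 := Multiset.count_eq_zero.2 fun h => absurd (hm2 1 h) (by norm_num)
  have hz : zPart p = c.factorial * m.prod * ∏ n ∈ m.toFinset, (m.count n).factorial := by
    have h4 : ∏ j ∈ p.parts.toFinset, (p.parts.count j).factorial =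
        ∏ j ∈ insert 1 m.toFinset, (p.parts.count j).factorial := by
      refine Finset.prod_subset ?_ ?_
      · intro j hj
        rw [hsplit, Multiset.mem_toFinset, Multiset.mem_add] at hj
        rcases hj with hj | hj
        · exact Finset.mem_insert_of_mem (Multiset.mem_toFinset.2 hj)
        · rw [Multiset.eq_of_mem_replicate hj]
          exact Finset.mem_insert_self _ _
      · intro j _ hj
        rw [Multiset.count_eq_zero.2 fun h => hj (Multiset.mem_toFinset.2 h), Nat.factorial_zero]
    have h5 : ∏ j ∈ m.toFinset, (p.parts.count j).factorial =
        ∏ j ∈ m.toFinset, (m.count j).factorial := by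
      refine Finset.prod_congr rfl fun j hj => ?_
      have : j ≠ 1 := by have := hm2 j (Multiset.mem_toFinset.1 hj); omega
      rw [hsplit, Multiset.count_add, Multiset.count_replicate, if_neg this.symm, add_zero]
    have h6 : p.parts.count 1 = c := by
      rw [hsplit, Multiset.count_add, h1, Multiset.count_replicate_self, zero_add]
    have h7 : p.parts.prod = m.prod := by
      rw [hsplit, Multiset.prod_add, Multiset.prod_replicate, one_pow, mul_one]
    rw [zPart, h4, Finset.prod_insert (by simpa using Multiset.count_eq_zero.1 h1), h5, h6, h7]
    ring
  have h := Perm.card_of_cycleType_mul_eq (α := Fin d) m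
  rw [Fintype.card_fin, if_pos ⟨hle, hm2⟩, ← hc, ← hz] at h
  rw [← h, Nat.card_eq_fintype_card, Fintype.card_subtype]
  simp only [hiff]

end CycleType
section Monotone

variable {d : ℕ}

/-- The pairs `(a, b)` satisfy `a < b` and the second entries are strictly increasing. -/
def StrictlyMonotonePairs (ab : List (Fin d × Fin d)) : Prop :=
  (∀ p ∈ ab, p.1 < p.2) ∧ ab.Pairwise fun p q => p.2 < q.2

/-- The product of the transpositions given by a list of pairs. -/
def swapProd (ab : List (Fin d × Fin d)) : Perm (Fin d) :=
  (ab.map fun p => Equiv.swap p.1 p.2).prod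

theorem isStrictlyMonotone_iff (l : List (Perm (Fin d))) :
    IsStrictlyMonotone l ↔
      ∃ ab, l = ab.map (fun p => Equiv.swap p.1 p.2) ∧ StrictlyMonotonePairs ab := by
  refine exists_congr fun ab => and_congr_right fun _ => and_congr_right fun _ => ?_
  exact List.isChain_iff_pairwise.trans List.pairwise_map

theorem strictlyMonotonePairs_concat {ab : List (Fin d × Fin d)} {p : Fin d × Fin d} :
    StrictlyMonotonePairs (ab ++ [p]) ↔
      StrictlyMonotonePairs ab ∧ p.1 < p.2 ∧ ∀ q ∈ ab, q.2 < p.2 := by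
  simp only [StrictlyMonotonePairs, List.pairwise_append, List.mem_append, List.mem_singleton]
  constructor
  · rintro ⟨h1, h2, -, h3⟩
    exact ⟨⟨fun q hq => h1 q (Or.inl hq), h2⟩, h1 p (Or.inr rfl), fun q hq => h3 q hq p rfl⟩
  · rintro ⟨⟨h1, h2⟩, h3, h4⟩
    refine ⟨?_, h2, List.pairwise_singleton _ _, ?_⟩
    · rintro q (hq | rfl)
      exacts [h1 q hq, h3]
    · rintro q hq _ rfl
      exact h4 q hq

theorem swapProd_concat (ab : List (Fin d × Fin d)) (p : Fin d × Fin d) :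
    swapProd (ab ++ [p]) = swapProd ab * Equiv.swap p.1 p.2 := by
  simp [swapProd]

theorem swapProd_apply_of_lt {ab : List (Fin d × Fin d)} (h : StrictlyMonotonePairs ab)
    {x : Fin d} (hx : ∀ p ∈ ab, p.2 < x) : swapProd ab x = x := by
  induction ab using List.reverseRecOn with
  | nil => rfl
  | append_singleton ab p ih =>
    rw [strictlyMonotonePairs_concat] at h
    have hp : p.2 < x := hx p (by simp)
    rw [swapProd_concat, Perm.mul_apply,
      Equiv.swap_apply_of_ne_of_ne (h.2.1.trans hp).ne' hp.ne']
    exact ih h.1 fun q hq => hx q (by simp [hq])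

theorem swapProd_concat_apply {ab : List (Fin d × Fin d)} {p : Fin d × Fin d}
    (h : StrictlyMonotonePairs (ab ++ [p])) : swapProd (ab ++ [p]) p.1 = p.2 := by
  rw [strictlyMonotonePairs_concat] at h
  rw [swapProd_concat, Perm.mul_apply, Equiv.swap_apply_left, swapProd_apply_of_lt h.1 h.2.2]

theorem swapProd_concat_apply_of_lt {ab : List (Fin d × Fin d)} {p : Fin d × Fin d}
    (h : StrictlyMonotonePairs (ab ++ [p])) {x : Fin d} (hx : p.2 < x) :
    swapProd (ab ++ [p]) x = x := by
  refine swapProd_apply_of_lt h fun q hq => ?_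
  rw [strictlyMonotonePairs_concat] at h
  rcases List.mem_append.1 hq with hq | hq
  · exact (h.2.2 q hq).trans hx
  · rwa [List.mem_singleton.1 hq]

theorem swapProd_injective {ab ab' : List (Fin d × Fin d)} (h : StrictlyMonotonePairs ab)
    (h' : StrictlyMonotonePairs ab') (e : swapProd ab = swapProd ab') : ab = ab' := by
  have aux : ∀ {l : List (Fin d × Fin d)} {p : Fin d × Fin d},
      StrictlyMonotonePairs (l ++ [p]) → swapProd (l ++ [p]) p.2 ≠ p.2 := by
    intro l p hl hp
    exact (strictlyMonotonePairs_concat.1 hl).2.1.ne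
      ((swapProd (l ++ [p])).injective ((swapProd_concat_apply hl).trans hp.symm))
  induction ab using List.reverseRecOn generalizing ab' with
  | nil =>
    rcases ab'.eq_nil_or_concat with rfl | ⟨l, p, rfl⟩
    · rfl
    · rw [List.concat_eq_append] at h' e
      exact absurd (by rw [← e]; rfl) (aux h')
  | append_singleton ab p ih =>
    rcases ab'.eq_nil_or_concat with rfl | ⟨l, q, rfl⟩
    · exact absurd (by rw [e]; rfl) (aux h)
    · rw [List.concat_eq_append] at h' e ⊢
      have h2 : p.2 = q.2 := by
        rcases lt_trichotomy p.2 q.2 with hlt | heq | hlt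
        · exact absurd (by rw [← e, swapProd_concat_apply_of_lt h hlt]) (aux h')
        · exact heq
        · exact absurd (by rw [e, swapProd_concat_apply_of_lt h' hlt]) (aux h)
      have h1 : p.1 = q.1 := (swapProd (ab ++ [p])).injective (by
        rw [swapProd_concat_apply h, h2, e, swapProd_concat_apply h'])
      obtain rfl : p = q := Prod.ext h1 h2
      rw [swapProd_concat, swapProd_concat, mul_left_inj] at e
      rw [ih (strictlyMonotonePairs_concat.1 h).1 (strictlyMonotonePairs_concat.1 h').1 e]

theorem exists_swapProd_eq_of_bound (n : ℕ) (σ : Perm (Fin d))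
    (hσ : ∀ x : Fin d, n ≤ x.val → σ x = x) :
    ∃ ab, StrictlyMonotonePairs ab ∧ (∀ p ∈ ab, p.2.val < n) ∧ swapProd ab = σ := by
  induction n generalizing σ with
  | zero =>
    refine ⟨[], ⟨by simp, List.Pairwise.nil⟩, by simp, ?_⟩
    ext x
    rw [hσ x (Nat.zero_le _)]
    rfl
  | succ n ih =>
    by_cases hn : ∀ x : Fin d, n ≤ x.val → σ x = x
    · obtain ⟨ab, h1, h2, h3⟩ := ih σ hn
      exact ⟨ab, h1, fun p hp => (h2 p hp).trans (Nat.lt_succ_self n), h3⟩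
    · push Not at hn
      obtain ⟨b, hb, hσb⟩ := hn
      have hbn : b.val = n := by
        by_contra hne
        exact hσb (hσ b (by omega))
      obtain ⟨a, ha⟩ := σ.surjective b
      have hab : a < b := by
        by_contra hle
        rcases (not_lt.1 hle).eq_or_lt with rfl | hlt
        · exact hσb ha
        · have := hσ a (by have : b.val < a.val := hlt; omega)
          rw [ha] at this
          exact hlt.ne this
      obtain ⟨ab, h1, h2, h3⟩ := ih (σ * Equiv.swap a b) fun x hx => by
        rw [Perm.mul_apply]
        by_cases hxb : x = b
        · rw [hxb, Equiv.swap_apply_right, ha]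
        · have hxn : n + 1 ≤ x.val := by
            have : x.val ≠ b.val := fun h => hxb (Fin.ext h)
            omega
          have hxa : x ≠ a := by
            rintro rfl
            have : x.val < b.val := hab
            omega
          rw [Equiv.swap_apply_of_ne_of_ne hxa hxb, hσ x hxn]
      refine ⟨ab ++ [(a, b)], strictlyMonotonePairs_concat.2 ⟨h1, hab, fun q hq => ?_⟩, ?_, ?_⟩
      · have := h2 q hq
        exact Fin.lt_def.2 (by simpa [hbn] using this)
      · intro p hp
        rcases List.mem_append.1 hp with hp | hp
        · exact (h2 p hp).trans (Nat.lt_succ_self n)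
        · rw [List.mem_singleton.1 hp]
          simp [hbn]
      · rw [swapProd_concat, h3, mul_assoc, Equiv.swap_mul_self, mul_one]

theorem exists_swapProd_eq (σ : Perm (Fin d)) :
    ∃ ab, StrictlyMonotonePairs ab ∧ swapProd ab = σ := by
  obtain ⟨ab, h1, -, h2⟩ := exists_swapProd_eq_of_bound d σ fun x hx => absurd x.2 (by omega)
  exact ⟨ab, h1, h2⟩

theorem cycleCount_swap_mul {α : Type*} [Finite α] [DecidableEq α] {s : Perm α} {x y : α}
    (h : ¬ s.SameCycle x y) : cycleCount (Equiv.swap x y * s) + 1 = cycleCount s := by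
  classical
  have hxy : x ≠ y := fun e => h (e ▸ Perm.SameCycle.refl _ _)
  let f : Fin 2 ↪ α := ⟨![x, y], by
    intro i j hij
    fin_cases i <;> fin_cases j <;> simp_all [eq_comm]⟩
  have hf : (Equiv.swap (0 : Fin 2) 1).viaEmbedding f = Equiv.swap x y := by
    ext z
    by_cases hz : z ∈ Set.range f
    · obtain ⟨i, rfl⟩ := hz
      rw [Perm.viaEmbedding_apply]
      revert i
      rw [Fin.forall_fin_two, Equiv.swap_apply_left, Equiv.swap_apply_right]
      exact ⟨(Equiv.swap_apply_left x y).symm, (Equiv.swap_apply_right x y).symm⟩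
    · rw [Perm.viaEmbedding_apply_of_notMem _ _ _ hz, Equiv.swap_apply_of_ne_of_ne]
      · rintro rfl
        exact hz ⟨0, rfl⟩
      · rintro rfl
        exact hz ⟨1, rfl⟩
  have hs : Separates s f := by
    intro i j hij
    fin_cases i <;> fin_cases j
    · rfl
    · exact absurd hij h
    · exact absurd hij.symm h
    · rfl
  have hc : cycleCount (Equiv.swap (0 : Fin 2) 1) = 1 := by
    have : ∀ i, (Equiv.swap (0 : Fin 2) 1).SameCycle 0 i := by
      intro i
      fin_cases i
      · exact Perm.SameCycle.refl _ _
      · exact ⟨1, by simp⟩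
    rw [cycleCount, Nat.card_eq_one_iff_unique]
    refine ⟨⟨fun p q => ?_⟩, ⟨Quot.mk _ 0⟩⟩
    rw [← Quot.out_eq p, ← Quot.out_eq q]
    exact quot_mk_eq_iff.2 ((this _).symm.trans (this _))
  have key := cycleCount_viaEmbedding_mul hs (Equiv.swap 0 1)
  rw [hf, hc, Nat.card_eq_fintype_card, Fintype.card_fin] at key
  omega

theorem cycleCount_swapProd {ab : List (Fin d × Fin d)} (h : StrictlyMonotonePairs ab) :
    cycleCount (swapProd ab) + ab.length = d := by
  induction ab using List.reverseRecOn with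
  | nil => simp [swapProd, cycleCount_one]
  | append_singleton ab p ih =>
    rw [strictlyMonotonePairs_concat] at h
    have hfix := swapProd_apply_of_lt h.1 h.2.2
    have hne : ¬ (swapProd ab).SameCycle (swapProd ab p.1) (swapProd ab p.2) := by
      rw [Perm.sameCycle_apply_left, Perm.sameCycle_apply_right]
      rintro hc
      obtain ⟨k, hk⟩ := hc.symm
      rw [Perm.zpow_apply_eq_self_of_apply_eq_self hfix] at hk
      exact h.2.1.ne' hk
    have := cycleCount_swap_mul hne
    rw [Equiv.swap_apply_apply, mul_assoc, mul_assoc, inv_mul_cancel, mul_one] at this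
    rw [swapProd_concat, List.length_append, List.length_singleton]
    have := ih h.1
    omega

theorem Hstrict_eq (d k : ℕ) (lam mu : Nat.Partition d) :
    Hstrict d k lam mu = (Nat.card {x : Perm (Fin d) × Perm (Fin d) //
      fullCycleType x.1 = lam.parts ∧ fullCycleType (x.1 * x.2) = mu.parts ∧
        cycleCount x.2 + k = d} : ℚ) / (d.factorial : ℚ) := by
  rw [Hstrict]
  congr 2
  refine Nat.card_congr (Equiv.ofBijective
    (fun t => ⟨(t.1.1, t.1.2.1.prod), t.2.1, ?_, ?_⟩) ⟨?_, ?_⟩)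
  · rw [← fullCycleType_inv, ← eq_inv_of_mul_eq_one_right t.2.2.2.2.2]
    exact t.2.2.1
  · obtain ⟨ab, hab, h⟩ := (isStrictlyMonotone_iff _).1 t.2.2.2.2.1
    have := cycleCount_swapProd h
    have hlen : ab.length = k := by simpa [hab] using t.2.2.2.1
    have hprod : t.1.2.1.prod = swapProd ab := congrArg List.prod hab
    show cycleCount t.1.2.1.prod + k = d
    rw [hprod]
    omega
  · rintro ⟨⟨ρ, l, τ⟩, _, _, _, hl, hρ⟩ ⟨⟨ρ', l', τ'⟩, _, _, _, hl', hρ'⟩ h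
    obtain ⟨h1, h2⟩ : ρ = ρ' ∧ l.prod = l'.prod := Prod.ext_iff.1 (Subtype.ext_iff.1 h)
    clear h
    obtain ⟨ab, rfl, hab⟩ := (isStrictlyMonotone_iff _).1 hl
    obtain ⟨ab', rfl, hab'⟩ := (isStrictlyMonotone_iff _).1 hl'
    obtain rfl := swapProd_injective hab hab' h2
    subst h1
    obtain rfl : τ = τ' := mul_left_cancel (hρ.trans hρ'.symm)
    rfl
  · rintro ⟨⟨ρ, r⟩, h1, h2, h3⟩
    obtain ⟨ab, hab, rfl⟩ := exists_swapProd_eq r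
    refine ⟨⟨(ρ, ab.map fun p => Equiv.swap p.1 p.2, (ρ * swapProd ab)⁻¹), h1, ?_, ?_,
      (isStrictlyMonotone_iff _).2 ⟨ab, rfl, hab⟩, mul_inv_cancel _⟩, rfl⟩
    · rw [fullCycleType_inv]
      exact h2
    · have := cycleCount_swapProd hab
      rw [List.length_map]
      simp only at h3
      omega

end Monotone
section LabelledMaps

variable {m d : ℕ}

/-- A map whose boundary edges are labelled by `Fin d` through `f`, in such a way that the
boundary faces are given by the permutation `ρ` of the labels. -/
structure IsLabelledMap (ρ : Perm (Fin d)) (a : ℤ) (nf : ℕ →₀ ℕ) (fs : Bool)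
    (f : Fin d ↪ Fin m) (s0 s1 s2 : Perm (Fin m)) : Prop where
  s1_invol : s1 * s1 = 1
  s1_fpf : ∀ x, s1 x ≠ x
  rel : s0 * s1 * s2 = 1
  semiconj : ∀ x, s2 (f x) = f (ρ x)
  euler : -((cycleCount s0 : ℤ) - cycleCount s1 + cycleCount s2 - cycleCount ρ) = a
  internal : ∀ i, Nat.card {q : Quot s2.SameCycle //
    orbitSize s2 q.out = i ∧ ∀ x, ¬ s2.SameCycle (f x) q.out} = nf i
  fullySimple : fs = true → Separates s0 f

/-- The type of labelled maps with edge set `Fin m` and boundary permutation `ρ`. -/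
abbrev LabelledMap (m : ℕ) (ρ : Perm (Fin d)) (a : ℤ) (nf : ℕ →₀ ℕ) (fs : Bool) :=
  {t : (Fin d ↪ Fin m) × Perm (Fin m) × Perm (Fin m) × Perm (Fin m) //
    IsLabelledMap ρ a nf fs t.1 t.2.1 t.2.2.1 t.2.2.2}

theorem viaEmbedding_inv {α β : Type*} (r : Perm α) (f : α ↪ β) :
    r⁻¹.viaEmbedding f = (r.viaEmbedding f)⁻¹ :=
  map_inv (Perm.viaEmbeddingHom f) r

theorem viaEmbedding_mul {α β : Type*} (r t : Perm α) (f : α ↪ β) :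
    (r * t).viaEmbedding f = r.viaEmbedding f * t.viaEmbedding f :=
  map_mul (Perm.viaEmbeddingHom f) r t

theorem mul_viaEmbedding_inv_apply_of_avoids {α β : Type*} (r : Perm α) {f : α ↪ β}
    {s u : Perm β} {x : β} (hx : ∀ i, ¬ u.SameCycle (f i) x) :
    (s * (r.viaEmbedding f)⁻¹) x = s x := by
  rw [Perm.mul_apply, ← viaEmbedding_inv,
    Perm.viaEmbedding_apply_of_notMem _ _ _ (notMem_range_of_avoids hx)]

theorem isLabelledMap_twist_iff {ρ r : Perm (Fin d)} {a : ℤ} {nf : ℕ →₀ ℕ}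
    {f : Fin d ↪ Fin m} {s0 s1 s2 : Perm (Fin m)} (hs : Separates s0 f) :
    IsLabelledMap (ρ * r) (a - (d - cycleCount r)) nf true f s0 s1 s2 ↔
      IsLabelledMap ρ a nf false f (r.viaEmbedding f * s0) s1 (s2 * (r.viaEmbedding f)⁻¹) := by
  have hsemi : (∀ x, s2 (f x) = f ((ρ * r) x)) ↔
      ∀ x, (s2 * (r.viaEmbedding f)⁻¹) (f x) = f (ρ x) := by
    refine Iff.trans (forall_congr' fun x => ?_) r.forall_congr_right
    rw [Perm.mul_apply s2, ← viaEmbedding_inv, Perm.viaEmbedding_apply, ← Perm.mul_apply r⁻¹,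
      inv_mul_cancel, Perm.one_apply, Perm.mul_apply]
  have hrel : s0 * s1 * s2 = 1 ↔
      r.viaEmbedding f * s0 * s1 * (s2 * (r.viaEmbedding f)⁻¹) = 1 := by
    rw [show r.viaEmbedding f * s0 * s1 * (s2 * (r.viaEmbedding f)⁻¹) =
      r.viaEmbedding f * (s0 * s1 * s2) * (r.viaEmbedding f)⁻¹ by group, conj_eq_one_iff]
  have hcount := card_avoiding_eq (s := s2) (t := s2 * (r.viaEmbedding f)⁻¹) (g := f)
    (fun x hx => mul_viaEmbedding_inv_apply_of_avoids r hx)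
    (fun x hx => (mul_viaEmbedding_inv_apply_of_avoids r hx).symm)
  have h0 := cycleCount_viaEmbedding_mul hs r
  rw [Nat.card_eq_fintype_card, Fintype.card_fin] at h0
  have h2 : (∀ x, s2 (f x) = f ((ρ * r) x)) → (cycleCount s2 : ℤ) - cycleCount (ρ * r) =
      cycleCount (s2 * (r.viaEmbedding f)⁻¹) - cycleCount ρ := by
    intro h
    have e1 := cycleCount_eq_add f fun x y => (sameCycle_iff_of_semiconj f h x y).symm
    have e2 := cycleCount_eq_add f fun x y =>
      (sameCycle_iff_of_semiconj f (hsemi.1 h) x y).symm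
    have e3 := hcount Set.univ
    simp only [Set.mem_univ, true_and] at e3
    omega
  constructor
  · intro h
    refine ⟨h.s1_invol, h.s1_fpf, hrel.1 h.rel, hsemi.1 h.semiconj, ?_, fun i => ?_,
      fun h => absurd h (by simp)⟩
    · have := h.euler
      have := h2 h.semiconj
      omega
    · rw [← h.internal i]
      exact (hcount {i}).symm
  · intro h
    refine ⟨h.s1_invol, h.s1_fpf, hrel.2 h.rel, hsemi.2 h.semiconj, ?_, fun i => ?_,
      fun _ => hs⟩
    · have := h.euler
      have := h2 (hsemi.2 h.semiconj)
      omega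
    · rw [← h.internal i]
      exact hcount {i}

/-- Every labelled map arises from a unique fully simple one by permuting the labels. -/
theorem card_labelledMap_eq_sum (m : ℕ) (ρ : Perm (Fin d)) (a : ℤ) (nf : ℕ →₀ ℕ) :
    Nat.card (LabelledMap m ρ a nf false) =
      ∑ r : Perm (Fin d), Nat.card (LabelledMap m (ρ * r) (a - (d - cycleCount r)) nf true) := by
  rw [← Nat.card_sigma]
  symm
  refine Nat.card_congr (Equiv.ofBijective (fun x =>
    ⟨(x.2.1.1, x.1.viaEmbedding x.2.1.1 * x.2.1.2.1, x.2.1.2.2.1,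
      x.2.1.2.2.2 * (x.1.viaEmbedding x.2.1.1)⁻¹),
      (isLabelledMap_twist_iff (x.2.2.fullySimple rfl)).1 x.2.2⟩) ⟨?_, ?_⟩)
  · rintro ⟨r, ⟨f, s0, s1, s2⟩, h⟩ ⟨r', ⟨f', s0', s1', s2'⟩, h'⟩ e
    simp only [Subtype.mk.injEq, Prod.mk.injEq] at e
    obtain ⟨rfl, e0, rfl, e2⟩ := e
    have hr : r'⁻¹ * r = 1 := by
      refine eq_one_of_separates_viaEmbedding_mul (h.fullySimple rfl) ?_
      rw [viaEmbedding_mul, viaEmbedding_inv, mul_assoc, e0, inv_mul_cancel_left]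
      exact h'.fullySimple rfl
    obtain rfl : r' = r := inv_mul_eq_one.1 hr
    obtain rfl := mul_left_cancel e0
    obtain rfl := mul_right_cancel e2
    rfl
  · rintro ⟨⟨f, s0, s1, s2⟩, h⟩
    obtain ⟨r, hr⟩ := exists_separates_viaEmbedding_mul s0 f
    refine ⟨⟨r, (f, (r.viaEmbedding f)⁻¹ * s0, s1, s2 * r.viaEmbedding f),
      (isLabelledMap_twist_iff hr).2 ?_⟩, ?_⟩
    · rw [mul_inv_cancel_left, mul_inv_cancel_right]
      exact h
    · simp

/-- Choosing a root on each cycle of `ρ` turns labelled maps into rooted maps. -/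
theorem card_labelledMap_eq_card_mapData (m : ℕ) {p : Nat.Partition d} {ρ : Perm (Fin d)}
    (hρ : fullCycleType ρ = p.parts) (a : ℤ) (nf : ℕ →₀ ℕ) (fs : Bool) :
    Nat.card (LabelledMap m ρ a nf fs) =
      Nat.card {M : MapData m (Multiset.card p.parts) // MCond p.parts a nf fs M} := by
  obtain ⟨R, hsize, hinj, hcover⟩ := exists_ordered_cycle_roots hρ
  have hn : cycleCount ρ = Multiset.card p.parts := by rw [← card_fullCycleType, hρ]
  have hmeet : ∀ {f : Fin d ↪ Fin m} {s2 : Perm (Fin m)}, (∀ x, s2 (f x) = f (ρ x)) →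
      ∀ y, (∃ i, s2.SameCycle (f (R i)) y) ↔ ∃ x, s2.SameCycle (f x) y := by
    intro f s2 h y
    constructor
    · rintro ⟨i, hi⟩
      exact ⟨_, hi⟩
    · rintro ⟨x, hx⟩
      obtain ⟨i, hi⟩ := hcover x
      exact ⟨i, ((sameCycle_iff_of_semiconj f h _ _).2 hi).trans hx⟩
  have hrange : ∀ {f : Fin d ↪ Fin m} {s2 : Perm (Fin m)}, (∀ x, s2 (f x) = f (ρ x)) →
      ∀ y, (∃ i, s2.SameCycle (f (R i)) y) ↔ ∃ x, f x = y := by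
    intro f s2 h y
    rw [hmeet h]
    constructor
    · rintro ⟨x, hx⟩
      exact mem_range_of_sameCycle h hx
    · rintro ⟨x, rfl⟩
      exact ⟨x, Perm.SameCycle.refl _ _⟩
  have hcond : ∀ (f : Fin d ↪ Fin m) (M : MapData m (Multiset.card p.parts)),
      (∀ x, M.s2 (f x) = f (ρ x)) → (∀ i, M.R i = f (R i)) →
      (IsLabelledMap ρ a nf fs f M.s0 M.s1 M.s2 ↔ MCond p.parts a nf fs M) := by
    intro f M hf hR
    have hdeg : M.boundaryDegrees = p.parts.sort (· ≤ ·) := by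
      rw [MapData.boundaryDegrees, ← hsize]
      simp only [hR, orbitSize_of_semiconj f hf]
    have hint : ∀ i, M.internalCount i = Nat.card {q : Quot M.s2.SameCycle //
        orbitSize M.s2 q.out = i ∧ ∀ x, ¬ M.s2.SameCycle (f x) q.out} := by
      intro i
      rw [MapData.internalCount]
      simp only [← not_exists, hR, hmeet hf]
    have hfs : M.FullySimple ↔ Separates M.s0 f := by
      simp only [MapData.FullySimple, hR, hrange hf]
      constructor
      · intro h i j hij
        exact f.injective (h _ _ ⟨i, rfl⟩ ⟨j, rfl⟩ hij)
      · rintro h _ _ ⟨i, rfl⟩ ⟨j, rfl⟩ hij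
        rw [h i j hij]
    simp only [MCond, hdeg, hint, hfs, MapData.eulerChar, true_and]
    constructor
    · intro h
      exact ⟨by have := h.euler; omega, h.internal, h.fullySimple⟩
    · rintro ⟨h1, h2, h3⟩
      exact ⟨M.s1_invol, M.s1_fpf, M.rel, hf, by omega, h2, h3⟩
  let toMap : LabelledMap m ρ a nf fs → MapData m (Multiset.card p.parts) := fun t =>
    { s0 := t.1.2.1
      s1 := t.1.2.2.1
      s2 := t.1.2.2.2
      R := fun i => t.1.1 (R i)
      s1_invol := t.2.s1_invol
      s1_fpf := t.2.s1_fpf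
      rel := t.2.rel
      roots_distinct := fun i j h =>
        hinj i j ((sameCycle_iff_of_semiconj _ t.2.semiconj _ _).1 h) }
  refine Nat.card_congr (Equiv.ofBijective
    (fun t => ⟨toMap t, (hcond t.1.1 (toMap t) t.2.semiconj fun _ => rfl).1 t.2⟩) ⟨?_, ?_⟩)
  · rintro ⟨⟨f, s0, s1, s2⟩, h⟩ ⟨⟨f', s0', s1', s2'⟩, h'⟩ e
    simp only [toMap, Subtype.mk.injEq, MapData.mk.injEq] at e
    obtain ⟨rfl, rfl, rfl, hR⟩ := e
    obtain rfl : f = f' := by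
      ext1 x
      obtain ⟨i, k, rfl⟩ := hcover x
      rw [← zpow_apply_of_semiconj h.semiconj, ← zpow_apply_of_semiconj h'.semiconj,
        congrFun hR i]
    rfl
  · rintro ⟨M, hM⟩
    have hsz : ∀ i, orbitSize M.s2 (M.R i) = orbitSize ρ (R i) :=
      congrFun (List.ofFn_injective (hM.1.trans hsize.symm))
    choose ι k hk using hcover
    let g : Fin d → Fin m := fun x => (M.s2 ^ k x) (M.R (ι x))
    have hg : ∀ i (l : ℤ), g ((ρ ^ l) (R i)) = (M.s2 ^ l) (M.R i) := by
      intro i l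
      have h1 := hk ((ρ ^ l) (R i))
      have h2 : ι ((ρ ^ l) (R i)) = i := hinj _ _
        (Perm.SameCycle.trans ⟨_, h1⟩ (Perm.SameCycle.symm ⟨l, rfl⟩))
      simp only [g]
      rw [h2] at h1 ⊢
      rw [zpow_apply_eq_zpow_apply_iff] at h1 ⊢
      rwa [hsz]
    have hginj : Function.Injective g := by
      intro x y hxy
      have h1 : ι x = ι y := M.roots_distinct _ _
        (Perm.SameCycle.trans ⟨k x, hxy⟩ (Perm.SameCycle.symm ⟨k y, rfl⟩))
      rw [← hk x, ← hk y]
      simp only [g] at hxy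
      rw [h1] at hxy ⊢
      rw [zpow_apply_eq_zpow_apply_iff] at hxy ⊢
      rwa [← hsz]
    have hsemi : ∀ x, M.s2 (g x) = g (ρ x) := by
      intro x
      have h1 : ρ x = (ρ ^ (1 + k x)) (R (ι x)) := by
        rw [zpow_add, zpow_one, Perm.mul_apply, hk]
      rw [h1, hg, zpow_add, zpow_one, Perm.mul_apply]
    have hroot : ∀ i, M.R i = g (R i) := fun i => by simpa using (hg i 0).symm
    refine ⟨⟨(⟨g, hginj⟩, M.s0, M.s1, M.s2), (hcond ⟨g, hginj⟩ M hsemi hroot).2 hM⟩, ?_⟩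
    refine Subtype.ext ?_
    cases M
    simp only [toMap, MapData.mk.injEq, true_and]
    exact funext fun i => (hroot i).symm

end LabelledMaps
section Enumeration

theorem finsum_one_div_card_stabilizer {G X : Type*} [Group G] [Finite G] [MulAction G X]
    [Finite X] (r : X → X → Prop) (hr : ∀ x y, r x y ↔ ∃ g : G, g • x = y) :
    ∑ᶠ c : Quot r, (1 : ℚ) / (Nat.card (MulAction.stabilizer G c.out) : ℚ) =
      (Nat.card X : ℚ) / (Nat.card G : ℚ) := by
  classical
  have := Fintype.ofFinite (Quot r)
  have hequiv : Equivalence r :=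
    ⟨fun x => (hr x x).2 ⟨1, one_smul G x⟩,
      fun {x y} h => by
        obtain ⟨g, rfl⟩ := (hr x y).1 h
        exact (hr _ _).2 ⟨g⁻¹, inv_smul_smul g x⟩,
      fun {x y z} h h' => by
        obtain ⟨g, rfl⟩ := (hr x y).1 h
        obtain ⟨g', rfl⟩ := (hr _ z).1 h'
        exact (hr _ _).2 ⟨g' * g, mul_smul g' g x⟩⟩
  have hfiber : ∀ c : Quot r, Nat.card {x // Quot.mk r x = c} *
      Nat.card (MulAction.stabilizer G c.out) = Nat.card G := by
    intro c
    rw [← Nat.card_congr (MulAction.orbitProdStabilizerEquivGroup G c.out), Nat.card_prod]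
    congr 1
    refine Nat.card_congr (Equiv.subtypeEquivRight fun x => ?_)
    rw [eq_comm]
    conv_lhs => rw [← Quot.out_eq c]
    rw [hequiv.quot_mk_eq_iff, hr]
    rfl
  have hsum : Nat.card X = ∑ c : Quot r, Nat.card {x // Quot.mk r x = c} := by
    rw [← Nat.card_sigma, Nat.card_congr (Equiv.sigmaFiberEquiv (Quot.mk r))]
  rw [finsum_eq_sum_of_fintype, hsum, Nat.cast_sum, Finset.sum_div]
  refine Finset.sum_congr rfl fun c _ => ?_
  have h1 : (Nat.card (MulAction.stabilizer G c.out) : ℚ) ≠ 0 :=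
    Nat.cast_ne_zero.2 Nat.card_pos.ne'
  have h2 : (Nat.card G : ℚ) ≠ 0 := Nat.cast_ne_zero.2 Nat.card_pos.ne'
  rw [div_eq_div_iff h1 h2, one_mul]
  exact_mod_cast (hfiber c).symm

theorem conj_apply {α : Type*} (g s : Perm α) (x : α) : (g * s * g⁻¹) (g x) = g (s x) := by
  simp

theorem cycleCount_conj {α : Type*} (g s : Perm α) :
    cycleCount (g * s * g⁻¹) = cycleCount s :=
  (Nat.card_congr (Quot.congr g fun x y =>
    (sameCycle_iff_of_semiconj g.toEmbedding (conj_apply g s) x y).symm)).symm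

variable {m n : ℕ}

theorem MapData.ext_of_eq {M M' : MapData m n} (h0 : M.s0 = M'.s0) (h1 : M.s1 = M'.s1)
    (h2 : M.s2 = M'.s2) (hR : M.R = M'.R) : M = M' := by
  cases M
  cases M'
  simp_all

theorem sameCycle_conj_apply {α : Type*} (g s : Perm α) (x y : α) :
    (g * s * g⁻¹).SameCycle (g x) (g y) ↔ s.SameCycle x y :=
  sameCycle_iff_of_semiconj g.toEmbedding (conj_apply g s) x y

theorem orbitSize_conj_apply {α : Type*} (g s : Perm α) (x : α) :
    orbitSize (g * s * g⁻¹) (g x) = orbitSize s x :=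
  orbitSize_of_semiconj g.toEmbedding (conj_apply g s) x

/-- Relabelling the edges of a map. -/
instance : MulAction (Perm (Fin m)) (MapData m n) where
  smul g M :=
    { s0 := g * M.s0 * g⁻¹
      s1 := g * M.s1 * g⁻¹
      s2 := g * M.s2 * g⁻¹
      R := fun i => g (M.R i)
      s1_invol := by
        rw [show g * M.s1 * g⁻¹ * (g * M.s1 * g⁻¹) = g * (M.s1 * M.s1) * g⁻¹ by group,
          M.s1_invol, mul_one, mul_inv_cancel]
      s1_fpf := fun x h => M.s1_fpf (g⁻¹ x) (by
        rwa [Perm.mul_apply, Perm.mul_apply, ← Perm.eq_inv_iff_eq] at h)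
      rel := by
        rw [show g * M.s0 * g⁻¹ * (g * M.s1 * g⁻¹) * (g * M.s2 * g⁻¹) =
          g * (M.s0 * M.s1 * M.s2) * g⁻¹ by group, M.rel, mul_one, mul_inv_cancel]
      roots_distinct := fun i j h =>
        M.roots_distinct i j ((sameCycle_conj_apply g _ _ _).1 h) }
  one_smul M := MapData.ext_of_eq (by change 1 * M.s0 * 1⁻¹ = _; group)
    (by change 1 * M.s1 * 1⁻¹ = _; group) (by change 1 * M.s2 * 1⁻¹ = _; group) rfl
  mul_smul g h M := MapData.ext_of_eq
    (by change g * h * M.s0 * (g * h)⁻¹ = g * (h * M.s0 * h⁻¹) * g⁻¹; group)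
    (by change g * h * M.s1 * (g * h)⁻¹ = g * (h * M.s1 * h⁻¹) * g⁻¹; group)
    (by change g * h * M.s2 * (g * h)⁻¹ = g * (h * M.s2 * h⁻¹) * g⁻¹; group) rfl

theorem internalCount_smul (g : Perm (Fin m)) (M : MapData m n) (i : ℕ) :
    (g • M).internalCount i = M.internalCount i := by
  let e : Quot M.s2.SameCycle ≃ Quot (g • M).s2.SameCycle :=
    Quot.congr g fun x y => (sameCycle_conj_apply g M.s2 x y).symm
  refine (Nat.card_congr (Equiv.subtypeEquiv e fun q => ?_)).symm
  have h : (g • M).s2.SameCycle (e q).out (g q.out) := by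
    rw [← quot_mk_eq_iff, Quot.out_eq]
    conv_lhs => rw [← Quot.out_eq q]
    rfl
  refine and_congr ?_ (forall_congr' fun j => not_congr ?_)
  · rw [orbitSize_congr h]
    exact (orbitSize_conj_apply g M.s2 q.out).symm ▸ Iff.rfl
  · rw [← sameCycle_conj_apply g M.s2]
    exact ⟨fun h' => h'.trans h.symm, fun h' => h'.trans h⟩

theorem mCond_smul_of_mCond {degs : Multiset ℕ} {a : ℤ} {nf : ℕ →₀ ℕ} {fs : Bool}
    (g : Perm (Fin m)) {M : MapData m n} (h : MCond degs a nf fs M) :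
    MCond degs a nf fs (g • M) := by
  obtain ⟨h1, h2, h3, h4⟩ := h
  refine ⟨?_, ?_, fun i => ?_, fun hf x y hx hy hxy => ?_⟩
  · rw [← h1]
    exact congrArg List.ofFn (funext fun i => orbitSize_conj_apply g M.s2 (M.R i))
  · rw [← h2]
    simp only [MapData.eulerChar]
    rw [show cycleCount (g • M).s0 = cycleCount M.s0 from cycleCount_conj g M.s0,
      show cycleCount (g • M).s1 = cycleCount M.s1 from cycleCount_conj g M.s1,
      show cycleCount (g • M).s2 = cycleCount M.s2 from cycleCount_conj g M.s2]
  · rw [internalCount_smul, h3]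
  · obtain ⟨x, rfl⟩ := g.surjective x
    obtain ⟨y, rfl⟩ := g.surjective y
    rw [h4 hf x y (hx.imp fun i => (sameCycle_conj_apply g M.s2 _ _).1)
      (hy.imp fun i => (sameCycle_conj_apply g M.s2 _ _).1)
      ((sameCycle_conj_apply g M.s0 _ _).1 hxy)]

theorem finite_mapData : Finite (MapData m n) :=
  Finite.of_injective (fun M => (M.s0, M.s1, M.s2, M.R)) fun M M' h => by
    simp only [Prod.mk.injEq] at h
    exact MapData.ext_of_eq h.1 h.2.1 h.2.2.1 h.2.2.2

theorem smul_eq_iff (g : Perm (Fin m)) (M M' : MapData m n) :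
    g • M = M' ↔ g * M.s0 * g⁻¹ = M'.s0 ∧ g * M.s1 * g⁻¹ = M'.s1 ∧ g * M.s2 * g⁻¹ = M'.s2 ∧
      ∀ i, g (M.R i) = M'.R i := by
  constructor
  · rintro rfl
    exact ⟨rfl, rfl, rfl, fun _ => rfl⟩
  · rintro ⟨h0, h1, h2, hR⟩
    exact MapData.ext_of_eq h0 h1 h2 (funext hR)

theorem mapEnum_eq (d : ℕ) (p : Nat.Partition d) (a : ℤ) (nf : ℕ →₀ ℕ) (fs : Bool) :
    mapEnum d p a nf fs =
      (Nat.card {M : MapData (d + nf.sum fun i k => i * k) (Multiset.card p.parts) //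
        MCond p.parts a nf fs M} : ℚ) / ((d + nf.sum fun i k => i * k).factorial : ℚ) := by
  have := finite_mapData (m := d + nf.sum fun i k => i * k) (n := Multiset.card p.parts)
  let act : MulAction (Perm (Fin (d + nf.sum fun i k => i * k)))
      {M : MapData (d + nf.sum fun i k => i * k) (Multiset.card p.parts) //
        MCond p.parts a nf fs M} :=
    { smul := fun g M => ⟨g • M.1, mCond_smul_of_mCond g M.2⟩
      one_smul := fun M => Subtype.ext (one_smul _ M.1)
      mul_smul := fun g h M => Subtype.ext (mul_smul g h M.1) }
  have hsmul : ∀ (g : Perm (Fin (d + nf.sum fun i k => i * k)))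
      (M M' : {M : MapData (d + nf.sum fun i k => i * k) (Multiset.card p.parts) //
        MCond p.parts a nf fs M}), g • M = M' ↔ g • M.1 = M'.1 :=
    fun g M M' => Subtype.ext_iff
  have key := finsum_one_div_card_stabilizer (G := Perm (Fin (d + nf.sum fun i k => i * k)))
    (X := {M : MapData (d + nf.sum fun i k => i * k) (Multiset.card p.parts) //
      MCond p.parts a nf fs M}) (fun M M' => MapEquivRel M.1 M'.1) fun M M' => by
    simp only [hsmul, smul_eq_iff, MapEquivRel]
  rw [Nat.card_perm, Nat.card_fin] at key
  rw [← key, mapEnum]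
  refine finsum_congr fun c => ?_
  congr 2
  refine Nat.card_congr (Equiv.subtypeEquivRight fun g => ?_)
  rw [MulAction.mem_stabilizer_iff, hsmul, smul_eq_iff]

theorem mapEnum_false_eq_sum (d : ℕ) {lam : Nat.Partition d} (a : ℤ) (nf : ℕ →₀ ℕ)
    {ρ : Perm (Fin d)} (hρ : fullCycleType ρ = lam.parts) :
    mapEnum d lam a nf false = ∑ r : Perm (Fin d),
      mapEnum d (cyclePartition (ρ * r)) (a - (d - cycleCount r)) nf true := by
  rw [mapEnum_eq, ← card_labelledMap_eq_card_mapData _ hρ, card_labelledMap_eq_sum,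
    Nat.cast_sum, Finset.sum_div]
  refine Finset.sum_congr rfl fun r _ => ?_
  rw [mapEnum_eq, ← card_labelledMap_eq_card_mapData _ (p := cyclePartition (ρ * r)) rfl]

theorem Hstrict_eq_zero_of_lt {d k : ℕ} (h : d < k) (lam mu : Nat.Partition d) :
    Hstrict d k lam mu = 0 := by
  have : IsEmpty {x : Perm (Fin d) × Perm (Fin d) //
      fullCycleType x.1 = lam.parts ∧ fullCycleType (x.1 * x.2) = mu.parts ∧
        cycleCount x.2 + k = d} := ⟨fun x => by have := x.2.2.2; omega⟩
  rw [Hstrict_eq, Nat.card_of_isEmpty, Nat.cast_zero, zero_div]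

theorem finite_support_Hstrict_mul (d : ℕ) (lam mu : Nat.Partition d) (F : ℕ → ℚ) :
    (Function.support fun k : ℕ => Hstrict d k lam mu * F k).Finite :=
  (Set.finite_Iic d).subset fun k hk => by
    by_contra hlt
    exact hk (show Hstrict d k lam mu * F k = 0 by
      rw [Hstrict_eq_zero_of_lt (not_le.1 hlt), zero_mul])

theorem sum_finsum_Hstrict_mul (d : ℕ) (lam : Nat.Partition d) (F : Nat.Partition d → ℕ → ℚ) :
    ∑ mu : Nat.Partition d, ∑ᶠ k : ℕ, Hstrict d k lam mu * F mu k =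
      (∑ ρ : {ρ : Perm (Fin d) // fullCycleType ρ = lam.parts}, ∑ r : Perm (Fin d),
        F (cyclePartition (ρ.1 * r)) (d - cycleCount r)) / (d.factorial : ℚ) := by
  classical
  have hH : ∀ mu k, Hstrict d k lam mu * F mu k =
      (∑ ρ : {ρ : Perm (Fin d) // fullCycleType ρ = lam.parts}, ∑ r : Perm (Fin d),
        if cyclePartition (ρ.1 * r) = mu ∧ cycleCount r + k = d then
          F mu k else 0) / (d.factorial : ℚ) := by
    intro mu k
    rw [Hstrict_eq, div_mul_eq_mul_div]
    congr 1
    rw [← Fintype.sum_prod_type', ← Finset.sum_filter, Finset.sum_const, nsmul_eq_mul]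
    congr 2
    rw [← Fintype.card_subtype, ← Nat.card_eq_fintype_card]
    refine Nat.card_congr
      { toFun := fun x => ⟨(⟨x.1.1, x.2.1⟩, x.1.2), (fullCycleType_eq_iff _ _).1 x.2.2.1, x.2.2.2⟩
        invFun := fun x => ⟨(x.1.1.1, x.1.2), x.1.1.2, (fullCycleType_eq_iff _ _).2 x.2.1, x.2.2⟩
        left_inv := fun _ => rfl
        right_inv := fun _ => rfl }
  have hfin : ∀ mu, ∑ᶠ k : ℕ, Hstrict d k lam mu * F mu k =
      ∑ k ∈ Finset.range (d + 1), Hstrict d k lam mu * F mu k := by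
    intro mu
    refine finsum_eq_sum_of_support_subset _ fun k hk => ?_
    by_contra hlt
    refine hk ?_
    have : d < k := by simpa using hlt
    simp only
    rw [Hstrict_eq_zero_of_lt this, zero_mul]
  rw [Finset.sum_congr rfl fun mu _ => hfin mu]
  simp only [hH, ← Finset.sum_div]
  congr 1
  rw [Finset.sum_congr rfl fun mu _ => Finset.sum_comm, Finset.sum_comm]
  refine Finset.sum_congr rfl fun ρ _ => ?_
  rw [Finset.sum_congr rfl fun mu _ => Finset.sum_comm, Finset.sum_comm]
  refine Finset.sum_congr rfl fun r _ => ?_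
  have hr : cycleCount r ≤ d := by simpa using cycleCount_le r
  rw [Finset.sum_eq_single (cyclePartition (ρ.1 * r)), Finset.sum_eq_single (d - cycleCount r)]
  · rw [if_pos ⟨rfl, by omega⟩]
  · intro k _ hk
    exact if_neg fun h => hk (by omega)
  · intro h
    exact absurd (Finset.mem_range.2 (by omega)) h
  · intro mu _ hmu
    exact Finset.sum_eq_zero fun k _ => if_neg fun h => hmu h.1.symm
  · intro h
    exact absurd (Finset.mem_univ _) h

end Enumeration

end FSM

open FSM in
/-- **Ordinary maps from fully simple maps via strictly monotone Hurwitz numbers.**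
For a partition `λ ⊢ d`, an integer `a` and a finitely supported internal-face-degree
function `n` (supported on `{1, 2, 3, …}`), the enumeration of ordinary maps satisfies
`Ord(λ; a, n) = z(λ) · Σ_{μ ⊢ d} Σ_{k ≥ 0} H^<_k(λ; μ) · FS(μ; a - k, n)`,
and for each `μ` the inner sum over `k` has only finitely many nonzero terms. -/
theorem ordinary_eq_strictMonotone_sum_fullySimple
    (d : ℕ) (hd : 0 < d) (lam : Nat.Partition d) (a : ℤ) (nf : ℕ →₀ ℕ)
    (hnf : nf 0 = 0) :
    (∀ mu : Nat.Partition d,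
      (Function.support fun k : ℕ =>
        Hstrict d k lam mu * mapEnum d mu (a - k) nf true).Finite) ∧
    mapEnum d lam a nf false =
      (zPart lam : ℚ) * ∑ mu : Nat.Partition d, ∑ᶠ k : ℕ,
        Hstrict d k lam mu * mapEnum d mu (a - k) nf true := by
  refine ⟨fun mu => finite_support_Hstrict_mul d lam mu _, ?_⟩
  rw [sum_finsum_Hstrict_mul d lam fun mu k => mapEnum d mu (a - k) nf true]
  have hsum : ∀ ρ : {ρ : Perm (Fin d) // fullCycleType ρ = lam.parts},
      ∑ r : Perm (Fin d), mapEnum d (cyclePartition (ρ.1 * r))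
        (a - ((d - cycleCount r : ℕ) : ℤ)) nf true = mapEnum d lam a nf false := by
    intro ρ
    rw [mapEnum_false_eq_sum d a nf ρ.2]
    refine Finset.sum_congr rfl fun r _ => ?_
    rw [Nat.cast_sub (by simpa using cycleCount_le r)]
  have hcard : (Nat.card {ρ : Perm (Fin d) // fullCycleType ρ = lam.parts} : ℚ) * zPart lam =
      d.factorial := by
    exact_mod_cast card_fullCycleType_eq_mul_zPart lam
  have hd0 : (d.factorial : ℚ) ≠ 0 := Nat.cast_ne_zero.2 d.factorial_ne_zero
  rw [Finset.sum_congr rfl fun ρ _ => hsum ρ, Finset.sum_const, Finset.card_univ,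
    ← Nat.card_eq_fintype_card, nsmul_eq_mul, mul_div_assoc', eq_div_iff hd0, ← hcard]
  ring
end

section
/- Let E be a finite set, let B ⊆ E, and let σ be a permutation of E. Then any two distinct elements of B lie in different cycles of the permutation (σ^∂)^{-1} σ; that is, each orbit of (σ^∂)^{-1} σ contains at most one element of B. -/
open Equiv
namespace FSM

variable {E : Type*} [Fintype E]

/-- The first-return time of `x` to `B` under `σ`: the smallest positive `r` with
`σ^r x ∈ B`. -/
noncomputable def retTime (σ : Perm E) (B : Set E) (x : E) : ℕ :=
  sInf {r : ℕ | 0 < r ∧ (σ ^ r) x ∈ B}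

theorem retTime_spec (σ : Perm E) (B : Set E) (x : E) (hx : x ∈ B) :
    0 < retTime σ B x ∧ (σ ^ retTime σ B x) x ∈ B := by
  have hne : {r : ℕ | 0 < r ∧ (σ ^ r) x ∈ B}.Nonempty := by
    refine ⟨orderOf σ, orderOf_pos σ, ?_⟩
    simp only [pow_orderOf_eq_one, Perm.coe_one, id_eq]
    exact hx
  exact Nat.sInf_mem hne

open Classical in
/-- The extension `σ^∂` to all of `E` (by the identity off `B`) of the first-return
permutation `∂(σ)` of `B`, as a function. -/
noncomputable def firstReturnFun (σ : Perm E) (B : Set E) (x : E) : E :=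
  if x ∈ B then (σ ^ retTime σ B x) x else x

theorem firstReturnFun_aux (σ : Perm E) (B : Set E) {x y : E} (hx : x ∈ B) (_hy : y ∈ B)
    (hle : retTime σ B x ≤ retTime σ B y)
    (h : (σ ^ retTime σ B x) x = (σ ^ retTime σ B y) y) : x = y := by
  obtain ⟨hrx, hmx⟩ := retTime_spec σ B x hx
  obtain ⟨t, ht⟩ : ∃ t, retTime σ B y = retTime σ B x + t :=
    ⟨retTime σ B y - retTime σ B x, (Nat.add_sub_cancel' hle).symm⟩
  rw [ht, pow_add] at h
  have h2 : x = (σ ^ t) y := (σ ^ retTime σ B x).injective (h.trans (Perm.mul_apply _ _ _))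
  rcases Nat.eq_zero_or_pos t with h0 | hpos
  · subst h0; simpa using h2
  · exfalso
    have hmem : (σ ^ t) y ∈ B := h2 ▸ hx
    have hle2 : retTime σ B y ≤ t := Nat.sInf_le ⟨hpos, hmem⟩
    omega

theorem firstReturnFun_injective (σ : Perm E) (B : Set E) :
    Function.Injective (firstReturnFun σ B) := by
  classical
  intro x y h
  unfold firstReturnFun at h
  by_cases hx : x ∈ B <;> by_cases hy : y ∈ B
  · rw [if_pos hx, if_pos hy] at h
    rcases le_total (retTime σ B x) (retTime σ B y) with hle | hle
    · exact firstReturnFun_aux σ B hx hy hle h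
    · exact (firstReturnFun_aux σ B hy hx hle h.symm).symm
  · rw [if_pos hx, if_neg hy] at h
    exact absurd (h ▸ (retTime_spec σ B x hx).2) hy
  · rw [if_neg hx, if_pos hy] at h
    exact absurd (h ▸ (retTime_spec σ B y hy).2) (h ▸ hx)
  · rwa [if_neg hx, if_neg hy] at h

/-- The permutation `σ^∂` of `E`: it agrees on `B` with the first-return permutation
`∂(σ)` of `B` (sending `b ∈ B` to `σ^r b` for the smallest positive `r` with
`σ^r b ∈ B`), and fixes every element of `E \ B`. -/
noncomputable def firstReturnPerm (σ : Perm E) (B : Set E) : Perm E :=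
  Equiv.ofBijective (firstReturnFun σ B)
    (Finite.injective_iff_bijective.mp (firstReturnFun_injective σ B))

end FSM
namespace FSM

theorem pow_apply_notMem_of_lt_retTime {E : Type*} (σ : Perm E) {B : Set E} {x : E} {k : ℕ}
    (hk : 0 < k) (hlt : k < retTime σ B x) : (σ ^ k) x ∉ B :=
  fun h => Nat.notMem_of_lt_sInf hlt ⟨hk, h⟩

variable {E : Type*} [Fintype E]

theorem firstReturnPerm_apply_mem (σ : Perm E) {B : Set E} {x : E} (hx : x ∈ B) :
    firstReturnPerm σ B x = (σ ^ retTime σ B x) x :=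
  if_pos hx

theorem firstReturnPerm_apply_notMem (σ : Perm E) {B : Set E} {x : E} (hx : x ∉ B) :
    firstReturnPerm σ B x = x :=
  if_neg hx

/-- The orbit of `x ∈ B` under `(σ^∂)⁻¹ σ` stays inside the segment
`x, σ x, …, σ^(r-1) x`, where `r` is the first-return time of `x`. -/
theorem exists_lt_retTime_pow_inv_mul_apply_eq (σ : Perm E) {B : Set E} {x : E} (hx : x ∈ B)
    (n : ℕ) :
    ∃ k < retTime σ B x, (((firstReturnPerm σ B)⁻¹ * σ) ^ n) x = (σ ^ k) x := by
  have hpos := (retTime_spec σ B x hx).1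
  induction n with
  | zero => exact ⟨0, hpos, rfl⟩
  | succ n ih =>
    obtain ⟨k, hk, hkx⟩ := ih
    rw [pow_succ', Perm.mul_apply, hkx, Perm.mul_apply, ← Perm.mul_apply σ, ← pow_succ']
    rcases (Nat.succ_le_of_lt hk).lt_or_eq with hlt | heq
    · refine ⟨k + 1, hlt, ?_⟩
      rw [Perm.inv_eq_iff_eq,
        firstReturnPerm_apply_notMem σ (pow_apply_notMem_of_lt_retTime σ k.succ_pos hlt)]
    · refine ⟨0, hpos, ?_⟩
      rw [Perm.inv_eq_iff_eq, pow_zero, Perm.one_apply, firstReturnPerm_apply_mem σ hx, ← heq]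

end FSM

open FSM in
/-- **Simplification separates boundary elements.**  For a finite set `E`, a subset
`B ⊆ E` and a permutation `σ` of `E`, any two distinct elements of `B` lie in
different cycles of `(σ^∂)⁻¹ σ`: each orbit of `(σ^∂)⁻¹ σ` contains at most one
element of `B`. -/
theorem firstReturnPerm_inv_mul_separates (E : Type*) [Fintype E] (B : Set E)
    (σ : Equiv.Perm E) :
    ∀ x ∈ B, ∀ y ∈ B, ((firstReturnPerm σ B)⁻¹ * σ).SameCycle x y → x = y := by
  intro x hx y hy hxy
  obtain ⟨n, -, hn⟩ := hxy.exists_pow_eq'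
  obtain ⟨k, hk, hkx⟩ := exists_lt_retTime_pow_inv_mul_apply_eq σ hx n
  rw [hn] at hkx
  rcases k.eq_zero_or_pos with rfl | hpos
  · exact hkx.symm
  · exact absurd (hkx ▸ hy) (pow_apply_notMem_of_lt_retTime σ hpos hk)
end

section
/- Let E be a finite set, B ⊆ E, let a be a permutation of E, and let b be a permutation of B. Then ∂(a) ∘ b = ∂(a ∘ ι(b)) as permutations of B, where ι(b) is the permutation of E agreeing with b on B and fixing E ∖ B, and composition is right to left (so (∂(a) ∘ b)(x) = ∂(a)(b(x))). -/
open Equiv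
namespace FSM

theorem mul_pow_apply_of_forall_notMem {E : Type*} {B : Set E} {a b : Perm E}
    (hb : ∀ x ∉ B, b x = x) (x : E) (n : ℕ)
    (h : ∀ j, 0 < j → j ≤ n → (a ^ j) (b x) ∉ B) :
    ((a * b) ^ (n + 1)) x = (a ^ (n + 1)) (b x) := by
  induction n with
  | zero => simp
  | succ n ih =>
    rw [pow_succ' (a * b), Perm.mul_apply, ih fun j hj hjn => h j hj (by omega), Perm.mul_apply,
      hb _ (h (n + 1) n.succ_pos le_rfl), pow_succ' a (n + 1), Perm.mul_apply]

theorem apply_mem_of_forall_notMem_fixed {E : Type*} {B : Set E} {b : Perm E}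
    (hb : ∀ x ∉ B, b x = x) {x : E} (hx : x ∈ B) : b x ∈ B := by
  by_contra h
  exact h (by rwa [b.injective (hb _ h)])

theorem isLeast_retTime {E : Type*} [Fintype E] (σ : Perm E) {B : Set E} {x : E} (hx : x ∈ B) :
    IsLeast {r : ℕ | 0 < r ∧ (σ ^ r) x ∈ B} (retTime σ B x) :=
  ⟨retTime_spec σ B x hx, fun _ hr => Nat.sInf_le hr⟩

theorem mul_pow_apply_of_le_retTime {E : Type*} [Fintype E] {B : Set E} {a b : Perm E}
    (hb : ∀ x ∉ B, b x = x) {x : E} {r : ℕ} (hr : 0 < r) (hle : r ≤ retTime a B (b x)) :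
    ((a * b) ^ r) x = (a ^ r) (b x) := by
  obtain ⟨n, rfl⟩ := Nat.exists_eq_add_one.mpr hr
  refine mul_pow_apply_of_forall_notMem hb x n fun j hj hjn hmem => ?_
  have hle' : retTime a B (b x) ≤ j := Nat.sInf_le ⟨hj, hmem⟩
  omega

theorem retTime_mul {E : Type*} [Fintype E] {B : Set E} (a : Perm E) {b : Perm E}
    (hb : ∀ x ∉ B, b x = x) {x : E} (hx : x ∈ B) :
    retTime (a * b) B x = retTime a B (b x) := by
  obtain ⟨hpos, hmem⟩ := retTime_spec a B (b x) (apply_mem_of_forall_notMem_fixed hb hx)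
  refine (isLeast_retTime (a * b) hx).unique ⟨⟨hpos, ?_⟩, fun r hr => ?_⟩
  · rwa [mul_pow_apply_of_le_retTime hb hpos le_rfl]
  · by_contra! hlt
    have hr' := hr.2
    rw [mul_pow_apply_of_le_retTime hb hr.1 hlt.le] at hr'
    exact hlt.not_ge (Nat.sInf_le ⟨hr.1, hr'⟩)

end FSM

open FSM in
/-- **Naturality of the first-return permutation.**  Let `E` be a finite set, `B ⊆ E`,
`a` a permutation of `E`, and `b` a permutation of `B` (represented by its extension to
`E` fixing `E \ B`).  Then `∂(a) ∘ b = ∂(a ∘ ι(b))` as permutations of `B`; here both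
sides are recorded via their extensions to `E` by the identity on `E \ B`, and
composition is right to left. -/
theorem firstReturnPerm_comp (E : Type*) [Fintype E] (B : Set E)
    (a b : Equiv.Perm E) (hb : ∀ x ∉ B, b x = x) :
    firstReturnPerm a B * b = firstReturnPerm (a * b) B := by
  ext x
  change firstReturnFun a B (b x) = firstReturnFun (a * b) B x
  by_cases hx : x ∈ B
  · have hbx := apply_mem_of_forall_notMem_fixed hb hx
    rw [firstReturnFun, firstReturnFun, if_pos hbx, if_pos hx, retTime_mul a hb hx,
      mul_pow_apply_of_le_retTime hb (retTime_spec a B _ hbx).1 le_rfl]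
  · rw [hb x hx, firstReturnFun, firstReturnFun, if_neg hx, if_neg hx]
end
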